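/- (Bryant's theorem) Let φ₀ be the standard G₂ 3-form on the Euclidean space ℝ⁷, namely the alternating trilinear form φ₀ = e^{123} − e^{167} − e^{527} − e^{563} − e^{415} − e^{426} − e^{437} in terms of the standard dual basis e¹,…,e⁷, where e^{ijk} = eⁱ ∧ eʲ ∧ eᵏ. If A is a linear automorphism of ℝ⁷ with A*φ₀ = φ₀ (i.e. φ₀(Ax, Ay, Az) = φ₀(x,y,z) for all x, y, z), then A is an orientation-preserving isometry: ⟨Ax, Ay⟩ = ⟨x, y⟩ for all x, y ∈ ℝ⁷ and det A = 1. -/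

import Mathlib

open scoped RealInnerProductSpace

/-- The basic 3-form `e^{ijk}` on `ℝ⁷`: `e^{ijk}(u,v,w)` is the determinant of
the 3×3 matrix of the `i`-th, `j`-th, `k`-th coordinates of `u`, `v`, `w`. -/
noncomputable def eform (i j k : Fin 7) (u v w : EuclideanSpace ℝ (Fin 7)) : ℝ :=
  Matrix.det !![u i, u j, u k; v i, v j, v k; w i, w j, w k]

/-- The standard G₂ 3-form
`φ₀ = e^{123} − e^{167} − e^{527} − e^{563} − e^{415} − e^{426} − e^{437}`
on `ℝ⁷` (with indices shifted to `0,…,6`). -/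
noncomputable def phi0 (u v w : EuclideanSpace ℝ (Fin 7)) : ℝ :=
  eform 0 1 2 u v w - eform 0 5 6 u v w - eform 4 1 6 u v w - eform 4 5 2 u v w
    - eform 3 0 4 u v w - eform 3 1 5 u v w - eform 3 2 6 u v w


set_option linter.unusedSimpArgs false

/-- Pfaffian of a `6 × 6` skew array, read off above the diagonal. -/
def pf6 (w : Fin 7 → Fin 7 → ℝ) (a b c d e f : Fin 7) : ℝ :=
  w a b * (w c d * w e f - w c e * w d f + w c f * w d e)
  - w a c * (w b d * w e f - w b e * w d f + w b f * w d e)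
  + w a d * (w b c * w e f - w b e * w c f + w b f * w c e)
  - w a e * (w b c * w d f - w b d * w c f + w b f * w c d)
  + w a f * (w b c * w d e - w b d * w c e + w b e * w c d)

/-- The coefficient of `α ∧ ω ∧ ω ∧ ω`. -/
def kform (α : Fin 7 → ℝ) (w : Fin 7 → Fin 7 → ℝ) : ℝ :=
  α 0 * pf6 w 1 2 3 4 5 6 - α 1 * pf6 w 0 2 3 4 5 6 + α 2 * pf6 w 0 1 3 4 5 6
  - α 3 * pf6 w 0 1 2 4 5 6 + α 4 * pf6 w 0 1 2 3 5 6 - α 5 * pf6 w 0 1 2 3 4 6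
  + α 6 * pf6 w 0 1 2 3 4 5

theorem kform_eq_zero (α : Fin 7 → ℝ) (w : Fin 7 → Fin 7 → ℝ)
    (hs : ∀ i j, w i j = - w j i) (i j : Fin 7) (hij : i < j)
    (ha : α i = α j) (hw : ∀ k, w i k = w j k) : kform α w = 0 := by
  have hd : ∀ k, w k k = 0 := fun k => by linarith [hs k k]
  have hw' : ∀ k, w k i = w k j := fun k => by rw [hs k i, hs k j, hw]
  have h0 : w i j = 0 := by rw [hw, hd]
  have s10 := hs 1 0
  have s20 := hs 2 0
  have s21 := hs 2 1
  have s30 := hs 3 0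
  have s31 := hs 3 1
  have s32 := hs 3 2
  have s40 := hs 4 0
  have s41 := hs 4 1
  have s42 := hs 4 2
  have s43 := hs 4 3
  have s50 := hs 5 0
  have s51 := hs 5 1
  have s52 := hs 5 2
  have s53 := hs 5 3
  have s54 := hs 5 4
  have s60 := hs 6 0
  have s61 := hs 6 1
  have s62 := hs 6 2
  have s63 := hs 6 3
  have s64 := hs 6 4
  have s65 := hs 6 5
  unfold kform pf6
  fin_cases i <;> fin_cases j <;> first
    | (exfalso; revert hij; decide)
    | (simp only [Fin.zero_eta, Fin.mk_one, Fin.reduceFinMk] at ha hw hw' h0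
       simp only [ha, hw, hw', h0, hd, s10, s20, s21, s30, s31, s32, s40, s41, s42, s43, s50, s51, s52, s53, s54, s60, s61, s62, s63, s64, s65]
       ring)

section
variable {E : Type*} [AddCommGroup E] [Module ℝ E]

set_option maxHeartbeats 4000000 in
theorem kalt_add (α : E →ₗ[ℝ] ℝ) (ω : E →ₗ[ℝ] E →ₗ[ℝ] ℝ) (v : Fin 7 → E) (i : Fin 7) (x y : E) :
    kform (fun j => α (Function.update v i (x + y) j))
      (fun j k => ω (Function.update v i (x + y) j) (Function.update v i (x + y) k)) =
    kform (fun j => α (Function.update v i x j))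
      (fun j k => ω (Function.update v i x j) (Function.update v i x k)) +
    kform (fun j => α (Function.update v i y j))
      (fun j k => ω (Function.update v i y j) (Function.update v i y k)) := by
  unfold kform pf6
  fin_cases i <;> simp [Function.update] <;> ring

set_option maxHeartbeats 4000000 in
theorem kalt_smul (α : E →ₗ[ℝ] ℝ) (ω : E →ₗ[ℝ] E →ₗ[ℝ] ℝ) (v : Fin 7 → E) (i : Fin 7) (c : ℝ)
    (x : E) :
    kform (fun j => α (Function.update v i (c • x) j))
      (fun j k => ω (Function.update v i (c • x) j) (Function.update v i (c • x) k)) =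
    c • kform (fun j => α (Function.update v i x j))
      (fun j k => ω (Function.update v i x j) (Function.update v i x k)) := by
  unfold kform pf6
  fin_cases i <;> simp [Function.update] <;> ring

/-- The alternating form `α ∧ ω ∧ ω ∧ ω` (up to a factor). -/
def kalt (α : E →ₗ[ℝ] ℝ) (ω : E →ₗ[ℝ] E →ₗ[ℝ] ℝ) (hs : ∀ x y, ω x y = - ω y x) :
    E [⋀^Fin 7]→ₗ[ℝ] ℝ :=
  { MultilinearMap.mk' (fun v : Fin 7 → E => kform (fun i => α (v i)) (fun i j => ω (v i) (v j)))
      (kalt_add α ω) (kalt_smul α ω) with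
    map_eq_zero_of_eq' := by
      intro v i j hij hne
      rcases lt_or_gt_of_ne hne with h | h
      · exact kform_eq_zero (fun i => α (v i)) (fun i j => ω (v i) (v j)) (fun _ _ => hs _ _) i j h (by simp only [hij]) (fun k => by simp only [hij])
      · exact kform_eq_zero (fun i => α (v i)) (fun i j => ω (v i) (v j)) (fun _ _ => hs _ _) j i h (by simp only [hij]) (fun k => by simp only [hij]) }

theorem kalt_apply (α : E →ₗ[ℝ] ℝ) (ω : E →ₗ[ℝ] E →ₗ[ℝ] ℝ) (hs : ∀ x y, ω x y = - ω y x)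
    (v : Fin 7 → E) :
    kalt α ω hs v = kform (fun i => α (v i)) (fun i j => ω (v i) (v j)) := rfl
end

/-- `φ₀(u, ·, ·)` as a bilinear map. -/
noncomputable def om (u : EuclideanSpace ℝ (Fin 7)) :
    EuclideanSpace ℝ (Fin 7) →ₗ[ℝ] EuclideanSpace ℝ (Fin 7) →ₗ[ℝ] ℝ :=
  LinearMap.mk₂ ℝ (fun x y => phi0 u x y)
    (by intros; simp [phi0, eform, Matrix.det_fin_three]; ring)
    (by intros; simp [phi0, eform, Matrix.det_fin_three]; ring)
    (by intros; simp [phi0, eform, Matrix.det_fin_three]; ring)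
    (by intros; simp [phi0, eform, Matrix.det_fin_three]; ring)

theorem om_apply (u x y : EuclideanSpace ℝ (Fin 7)) : om u x y = phi0 u x y := rfl

theorem om_skew (u x y : EuclideanSpace ℝ (Fin 7)) : om u x y = - om u y x := by
  simp [om_apply, phi0, eform, Matrix.det_fin_three]; ring

/-- The standard basis. -/
noncomputable def sb : Module.Basis (Fin 7) ℝ (EuclideanSpace ℝ (Fin 7)) :=
  (EuclideanSpace.basisFun (Fin 7) ℝ).toBasis

theorem sb_apply (i j : Fin 7) : sb i j = if j = i then 1 else 0 := by
  simp [sb, Pi.single_apply]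

theorem om_sb (u : EuclideanSpace ℝ (Fin 7)) (i j : Fin 7) :
    om u (sb i) (sb j) = !![0, u 2, -u 1, u 4, -u 3, -u 6, u 5;
      -u 2, 0, u 0, u 5, u 6, -u 3, -u 4;
      u 1, -u 0, 0, u 6, -u 5, u 4, -u 3;
      -u 4, -u 5, -u 6, 0, u 0, u 1, u 2;
      u 3, -u 6, u 5, -u 0, 0, -u 2, u 1;
      u 6, u 3, -u 4, -u 1, u 2, 0, -u 0;
      -u 5, u 4, u 3, -u 2, -u 1, u 0, 0] i j := by
  rw [om_apply]
  fin_cases i <;> fin_cases j <;> simp [phi0, eform, Matrix.det_fin_three, sb_apply]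

theorem kalt_sb (u : EuclideanSpace ℝ (Fin 7)) (α : EuclideanSpace ℝ (Fin 7) →ₗ[ℝ] ℝ) :
    kalt α (om u) (om_skew u) sb = - (⟪u, u⟫ * α u) := by
  have hu : α u = ∑ i, u i * α (sb i) := by
    conv_lhs => rw [← sb.sum_repr u]
    simp [sb]
  have hn : (⟪u, u⟫ : ℝ) = ∑ i, u i * u i := by
    rw [PiLp.inner_apply]; rfl
  rw [hu, hn, kalt_apply]
  simp only [kform, pf6, om_sb]
  simp [Fin.sum_univ_succ]
  ring

theorem bryant_key (A : EuclideanSpace ℝ (Fin 7) →ₗ[ℝ] EuclideanSpace ℝ (Fin 7))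
    (hA : Function.Bijective A)
    (hphi : ∀ x y z : EuclideanSpace ℝ (Fin 7), phi0 (A x) (A y) (A z) = phi0 x y z)
    (u : EuclideanSpace ℝ (Fin 7)) : LinearMap.det A * ⟪A u, A u⟫ = ⟪u, u⟫ := by
  by_cases hu : u = 0
  · simp [hu]
  have hAu : A u ≠ 0 := fun h => hu (hA.1 (by rw [h, map_zero]))
  have hne : ⟪A u, A u⟫ ≠ (0 : ℝ) := by simpa using hAu
  let α : EuclideanSpace ℝ (Fin 7) →ₗ[ℝ] ℝ := (innerₗ _ (A u))
  have h1 : kalt α (om (A u)) (om_skew _) (A ∘ sb)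
      = kalt (α ∘ₗ A) (om u) (om_skew _) sb := by
    simp only [kalt_apply, om_apply, Function.comp, hphi, LinearMap.comp_apply]
  have h2 := congrArg (fun F => F (A ∘ sb))
    ((kalt α (om (A u)) (om_skew _)).eq_smul_basis_det sb)
  simp only [AlternatingMap.smul_apply, Module.Basis.det_comp, Module.Basis.det_self] at h2
  rw [h1, kalt_sb, kalt_sb] at h2
  have e : α (A u) = ⟪A u, A u⟫ := rfl
  simp only [LinearMap.comp_apply, e, smul_eq_mul] at h2
  apply mul_right_cancel₀ hne
  linarith

/-- **Bryant's theorem**: any linear automorphism of `ℝ⁷` preserving the standard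
G₂ 3-form `φ₀` is an orientation-preserving isometry. -/
theorem bryant_G2_preserves_metric_and_orientation
    (A : EuclideanSpace ℝ (Fin 7) →ₗ[ℝ] EuclideanSpace ℝ (Fin 7))
    (hA : Function.Bijective A)
    (hphi : ∀ x y z : EuclideanSpace ℝ (Fin 7), phi0 (A x) (A y) (A z) = phi0 x y z) :
    (∀ x y : EuclideanSpace ℝ (Fin 7), ⟪A x, A y⟫ = ⟪x, y⟫) ∧ LinearMap.det A = 1 := by
  have key := bryant_key A hA hphi
  set d := LinearMap.det A with hd
  have pol : ∀ x y, d * ⟪A x, A y⟫ = ⟪x, y⟫ := by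
    intro x y
    have h := key (x + y)
    simp only [map_add, inner_add_left, inner_add_right, real_inner_comm (A x) (A y),
      real_inner_comm x y] at h
    linarith [key x, key y, real_inner_comm (A x) (A y), real_inner_comm x y]
  have hd0 : 0 ≤ d := by
    by_contra hneg
    have h := key (EuclideanSpace.single 0 1)
    have h1 : (⟪(EuclideanSpace.single 0 1 : EuclideanSpace ℝ (Fin 7)),
      EuclideanSpace.single 0 1⟫ : ℝ) = 1 := by simp
    rw [h1] at h
    nlinarith [real_inner_self_nonneg (x := A (EuclideanSpace.single 0 1))]
  have hadj : d • (LinearMap.adjoint A ∘ₗ A) = LinearMap.id := by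
    ext1 x
    refine ext_inner_right ℝ fun y => ?_
    simp [inner_smul_left, LinearMap.adjoint_inner_left, pol]
  have hdet := congrArg LinearMap.det hadj
  have hdadj : LinearMap.det (LinearMap.adjoint A) = d := by
    rw [hd, ← LinearMap.det_toMatrix (EuclideanSpace.basisFun (Fin 7) ℝ).toBasis,
      LinearMap.toMatrix_adjoint, Matrix.det_conjTranspose, LinearMap.det_toMatrix]
    simp
  rw [LinearMap.det_smul, LinearMap.det_comp, LinearMap.det_id, hdadj, ← hd] at hdet
  have h9 : d ^ 9 = 1 := by
    rw [← hdet]; simp; ring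
  have h1 : d = 1 := (pow_eq_one_iff_of_nonneg hd0 (by norm_num)).1 h9
  refine ⟨fun x y => ?_, h1⟩
  have := pol x y
  rwa [h1, one_mul] at this
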